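/- If a strongly regular graph G with parameters (1911, 270, 105, 27) exists, then G contains an induced quadrangle, i.e., there exist four distinct vertices x, u, y, v such that x ~ u, u ~ y, y ~ v, v ~ x, while x is not adjacent to y and u is not adjacent to v. -/

import Mathlib

namespace SimpleGraph

variable {V : Type*} (G : SimpleGraph V)

/-- A graph without induced quadrangles. -/
def QuadrangleFree : Prop :=
  ∀ ⦃x u y v : V⦄, x ≠ y → u ≠ v → G.Adj x u → G.Adj u y → G.Adj y v → G.Adj v x →
    ¬ G.Adj x y → G.Adj u v

variable {G} [Fintype V] [DecidableEq V] [DecidableRel G.Adj]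

local notation "N" => G.neighborFinset

theorem IsSRGWith.card_inter_of_adj {n k l m : ℕ} (h : G.IsSRGWith n k l m) {a b : V}
    (hab : G.Adj a b) : (N a ∩ N b).card = l := by
  rw [← h.of_adj a b hab, ← Set.toFinset_card]
  congr 1
  ext c
  simp [mem_commonNeighbors]

theorem IsSRGWith.card_inter_of_not_adj {n k l m : ℕ} (h : G.IsSRGWith n k l m) {a b : V}
    (hne : a ≠ b) (hab : ¬ G.Adj a b) : (N a ∩ N b).card = m := by
  rw [← h.of_not_adj hne hab, ← Set.toFinset_card]
  congr 1
  ext c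
  simp [mem_commonNeighbors]

/-- Adjacent private neighbours of two non-adjacent vertices have the same neighbours among the
common ones. -/
theorem QuadrangleFree.inter_eq_inter (hq : G.QuadrangleFree) {a b c d : V} (hab : ¬ G.Adj a b)
    (hc : c ∈ N a \ N b) (hd : d ∈ N b \ N a) (hcd : G.Adj c d) :
    N c ∩ (N a ∩ N b) = N d ∩ (N a ∩ N b) := by
  simp only [Finset.mem_sdiff, mem_neighborFinset] at hc hd
  ext e
  simp only [Finset.mem_inter, mem_neighborFinset]
  refine and_congr_left fun ⟨hae, hbe⟩ => ⟨fun hce => ?_, fun hde => ?_⟩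
  · refine hq (x := c) (y := b) ?_ ?_ hcd hd.1.symm hbe hce.symm fun h => hc.2 h.symm
    · rintro rfl; exact hab hc.1
    · rintro rfl; exact hd.2 hae
  · refine hq (x := d) (y := a) ?_ ?_ hcd.symm hc.1.symm hae hde.symm fun h => hd.2 h.symm
    · rintro rfl; exact hab hd.1.symm
    · rintro rfl; exact hc.2 hbe

/-- A weighted count of the edges between the private neighbourhoods of two non-adjacent
vertices. -/
theorem QuadrangleFree.card_filter_sdiff_eq_sum (hq : G.QuadrangleFree) {m : ℕ}
    (hm : ∀ a b, a ≠ b → ¬ G.Adj a b → (N a ∩ N b).card = m) {a b : V} (hne : a ≠ b)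
    (hab : ¬ G.Adj a b) {S : Finset V} (hS : S ⊆ N a ∩ N b) :
    (({c ∈ N a \ N b | ¬ S ⊆ N c} : Finset V).card : ℚ) =
      ∑ c ∈ N a \ N b with ¬ S ⊆ N c, ∑ d ∈ N b \ N a with ¬ S ⊆ N d,
        if G.Adj c d then ((m : ℚ) - (N c ∩ (N a ∩ N b)).card)⁻¹ else 0 := by
  rw [Finset.card_eq_sum_ones, Nat.cast_sum]
  refine Finset.sum_congr rfl fun c hc => ?_
  obtain ⟨hc, hSc⟩ := Finset.mem_filter.1 hc
  have hc' := hc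
  simp only [Finset.mem_sdiff, mem_neighborFinset] at hc'
  have hlt : (N c ∩ (N a ∩ N b)).card < m := by
    rw [← hm a b hne hab]
    refine Finset.card_lt_card ⟨Finset.inter_subset_right, fun hsub => hSc fun s hs => ?_⟩
    exact (Finset.mem_inter.1 (hsub (hS hs))).1
  have hset : ({d ∈ ({d ∈ N b \ N a | ¬ S ⊆ N d} : Finset V) | G.Adj c d} : Finset V)
      = (N c ∩ N b) \ (N c ∩ (N a ∩ N b)) := by
    ext d
    simp only [Finset.mem_filter, Finset.mem_sdiff, Finset.mem_inter, mem_neighborFinset]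
    constructor
    · tauto
    · rintro ⟨⟨hcd, hbd⟩, hn⟩
      have had : ¬ G.Adj a d := by tauto
      have hd : d ∈ N b \ N a := by simp [hbd, had]
      have heq := hq.inter_eq_inter hab hc hd hcd
      refine ⟨⟨⟨hbd, had⟩, fun hSd => hSc fun s hs => ?_⟩, hcd⟩
      have : s ∈ N d ∩ (N a ∩ N b) := Finset.mem_inter.2 ⟨hSd hs, hS hs⟩
      rw [← heq] at this
      exact (Finset.mem_inter.1 this).1
  have hcb : c ≠ b := by rintro rfl; exact hab hc'.1
  have hcard : (({d ∈ ({d ∈ N b \ N a | ¬ S ⊆ N d} : Finset V) | G.Adj c d} : Finset V).card : ℚ)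
      = m - (N c ∩ (N a ∩ N b)).card := by
    rw [hset, Finset.cast_card_sdiff
      (Finset.inter_subset_inter_left Finset.inter_subset_right),
      hm c b hcb fun h => hc'.2 h.symm]
  rw [← Finset.sum_filter, Finset.sum_const, nsmul_eq_mul, hcard, mul_inv_cancel₀, Nat.cast_one]
  have : ((N c ∩ (N a ∩ N b)).card : ℚ) < m := by exact_mod_cast hlt
  linarith

theorem QuadrangleFree.card_filter_sdiff_eq (hq : G.QuadrangleFree) {m : ℕ}
    (hm : ∀ a b, a ≠ b → ¬ G.Adj a b → (N a ∩ N b).card = m) {a b : V} (hne : a ≠ b)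
    (hab : ¬ G.Adj a b) {S : Finset V} (hS : S ⊆ N a ∩ N b) :
    ({c ∈ N a \ N b | ¬ S ⊆ N c} : Finset V).card =
      ({c ∈ N b \ N a | ¬ S ⊆ N c} : Finset V).card := by
  have h1 := hq.card_filter_sdiff_eq_sum hm hne hab hS
  have h2 := hq.card_filter_sdiff_eq_sum hm hne.symm (fun h => hab h.symm)
    (S := S) (by rwa [Finset.inter_comm])
  have : (({c ∈ N a \ N b | ¬ S ⊆ N c} : Finset V).card : ℚ) =
      ({c ∈ N b \ N a | ¬ S ⊆ N c} : Finset V).card := by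
    rw [h1, h2, Finset.sum_comm]
    refine Finset.sum_congr rfl fun d hd => Finset.sum_congr rfl fun c hc => ?_
    by_cases hcd : G.Adj c d
    · rw [if_pos hcd, if_pos hcd.symm, hq.inter_eq_inter hab (Finset.mem_filter.1 hc).1
        (Finset.mem_filter.1 hd).1 hcd, Finset.inter_comm (N a)]
    · rw [if_neg hcd, if_neg fun h => hcd h.symm]
  exact_mod_cast this

/-- In a regular quadrangle-free graph in which non-adjacent vertices have a constant number of
common neighbours, two non-adjacent vertices have equally many common neighbours with any set of
their common neighbours. -/
theorem QuadrangleFree.card_filter_neighborFinset_eq (hq : G.QuadrangleFree) {k m : ℕ}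
    (hk : G.IsRegularOfDegree k)
    (hm : ∀ a b, a ≠ b → ¬ G.Adj a b → (N a ∩ N b).card = m) {a b : V} (hne : a ≠ b)
    (hab : ¬ G.Adj a b) {S : Finset V} (hS : S ⊆ N a ∩ N b) :
    ({c ∈ N a | S ⊆ N c} : Finset V).card = ({c ∈ N b | S ⊆ N c} : Finset V).card := by
  have h := hq.card_filter_sdiff_eq hm hne hab hS
  have key : ∀ a b : V, ({c ∈ N a | S ⊆ N c} : Finset V).card
      + ({c ∈ N a \ N b | ¬ S ⊆ N c} : Finset V).card
      + ({c ∈ N a ∩ N b | ¬ S ⊆ N c} : Finset V).card = k := by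
    intro a b
    rw [← hk.degree_eq a, ← card_neighborFinset_eq_degree,
      ← Finset.card_filter_add_card_filter_not (s := N a) (fun c => S ⊆ N c), add_assoc]
    congr 1
    rw [← Finset.card_union_of_disjoint, ← Finset.filter_union, Finset.sdiff_union_inter]
    exact Finset.disjoint_filter_filter (Finset.disjoint_sdiff_inter _ _)
  have h1 := key a b
  have h2 := key b a
  rw [Finset.inter_comm (N b)] at h2
  omega

variable (G) in
/-- The neighbours of `x` and `u` that are distinct from and not adjacent to `w`. -/
def coNeighbors (x u w : V) : Finset V :=
  {c ∈ N x ∩ N u | c ≠ w ∧ ¬ G.Adj w c}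

theorem card_coNeighbors_add {x u w : V} (hx : G.Adj x w) (hu : G.Adj u w) :
    (G.coNeighbors x u w).card + (N x ∩ N u ∩ N w).card + 1 = (N x ∩ N u).card := by
  have hw : w ∉ N x ∩ N u ∩ N w := by simp
  rw [add_assoc, ← Finset.card_insert_of_notMem hw, ← Finset.card_union_of_disjoint]
  · congr 1
    ext c
    simp only [coNeighbors, Finset.mem_union, Finset.mem_filter, Finset.mem_insert,
      Finset.mem_inter, mem_neighborFinset]
    by_cases hc : c = w
    · subst hc; simp [hx, hu]
    · tauto
  · rw [Finset.disjoint_left]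
    intro c
    simp only [coNeighbors, Finset.mem_filter, Finset.mem_insert, Finset.mem_inter,
      mem_neighborFinset]
    tauto

theorem QuadrangleFree.card_coNeighbors_eq_of_not_adj (hq : G.QuadrangleFree) {k m : ℕ}
    (hk : G.IsRegularOfDegree k)
    (hm : ∀ a b, a ≠ b → ¬ G.Adj a b → (N a ∩ N b).card = m) {x u a b : V}
    (ha : a ∈ N x ∩ N u) (hb : b ∈ N x ∩ N u) (hab : ¬ G.Adj a b) :
    (G.coNeighbors x u a).card = (G.coNeighbors x u b).card := by
  obtain rfl | hne := eq_or_ne a b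
  · rfl
  simp only [Finset.mem_inter, mem_neighborFinset] at ha hb
  have h1 := card_coNeighbors_add ha.1 ha.2
  have h2 := card_coNeighbors_add hb.1 hb.2
  have h := hq.card_filter_neighborFinset_eq hk hm hne hab (S := {x, u}) (by
    intro s hs
    simp only [Finset.mem_insert, Finset.mem_singleton] at hs
    rcases hs with rfl | rfl <;> simp [ha.1.symm, ha.2.symm, hb.1.symm, hb.2.symm])
  have hset : ∀ a, ({c ∈ N a | ({x, u} : Finset V) ⊆ N c} : Finset V) = N x ∩ N u ∩ N a := by
    intro a
    ext c
    simp only [Finset.mem_filter, Finset.insert_subset_iff, Finset.singleton_subset_iff,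
      Finset.mem_inter, mem_neighborFinset, G.adj_comm c]
    tauto
  rw [hset, hset] at h
  omega

theorem QuadrangleFree.card_coNeighbors_eq (hq : G.QuadrangleFree) {k m : ℕ}
    (hk : G.IsRegularOfDegree k)
    (hm : ∀ a b, a ≠ b → ¬ G.Adj a b → (N a ∩ N b).card = m) {x u a b : V}
    (ha : a ∈ N x ∩ N u) (hb : b ∈ N x ∩ N u) (ha' : (G.coNeighbors x u a).Nonempty)
    (hb' : (G.coNeighbors x u b).Nonempty) :
    (G.coNeighbors x u a).card = (G.coNeighbors x u b).card := by
  obtain ⟨c, hc⟩ := ha'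
  obtain ⟨d, hd⟩ := hb'
  obtain ⟨hc, hca, hac⟩ := Finset.mem_filter.1 hc
  obtain ⟨hd, hdb, hbd⟩ := Finset.mem_filter.1 hd
  have eq {p q : V} (hp : p ∈ N x ∩ N u) (hr : q ∈ N x ∩ N u) (hpq : ¬ G.Adj p q) :=
    hq.card_coNeighbors_eq_of_not_adj hk hm hp hr hpq
  have e1 := eq ha hc hac
  have e2 := eq hb hd hbd
  by_contra hne
  have hab : G.Adj a b := by by_contra h; exact hne (eq ha hb h)
  have had : G.Adj a d := by by_contra h; exact hne ((eq ha hd h).trans e2.symm)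
  have hcb : G.Adj c b := by by_contra h; exact hne (e1.trans (eq hc hb h))
  have hcd : G.Adj c d := by by_contra h; exact hne ((e1.trans (eq hc hd h)).trans e2.symm)
  exact hbd (hq hca.symm hdb.symm hab hcb.symm hcd had.symm hac)

variable (G) in
/-- The vertices of the local graph at `x` with the same closed neighbourhood there as `u`. -/
def localTwins (x u : V) : Finset V :=
  {w ∈ N x | insert w (N x ∩ N w) = insert u (N x ∩ N u)}

theorem dvd_card_of_localTwins {x : V} {d : ℕ} {S : Finset V} (hSx : S ⊆ N x)
    (hS : ∀ u ∈ S, G.localTwins x u ⊆ S) (hd : ∀ u ∈ S, d ∣ (G.localTwins x u).card) :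
    d ∣ S.card := by
  rw [Finset.card_eq_sum_card_image (fun w => insert w (N x ∩ N w))]
  refine Finset.dvd_sum fun T hT => ?_
  obtain ⟨u, hu, rfl⟩ := Finset.mem_image.1 hT
  refine (hd u hu).trans (dvd_of_eq (congrArg Finset.card ?_))
  ext w
  simp only [localTwins, Finset.mem_filter]
  exact and_congr_left fun hw =>
    ⟨fun h => hS u hu (Finset.mem_filter.2 ⟨h, hw⟩), fun h => hSx h⟩

theorem localTwins_subset_coNeighbors {x u a w : V} (hw : w ∈ G.coNeighbors x u a) (hu : G.Adj x u)
    (ha : G.Adj x a) (hau : G.Adj u a) : G.localTwins x w ⊆ G.coNeighbors x u a := by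
  intro v hv
  simp only [localTwins, coNeighbors, Finset.mem_filter, Finset.ext_iff, Finset.mem_insert,
    Finset.mem_inter, mem_neighborFinset] at hv hw ⊢
  have h1 := hv.2 u
  have h2 := hv.2 a
  have h3 := hv.2 v
  have := G.adj_comm u v
  have := G.adj_comm u w
  have := G.adj_comm a w
  have := G.adj_comm a v
  grind

theorem localTwins_eq {x u : V} {l : ℕ} (hl : ∀ a b, G.Adj a b → (N a ∩ N b).card = l)
    (hu : G.Adj x u) :
    G.localTwins x u = insert u {w ∈ N x ∩ N u | ¬ (G.coNeighbors x u w).Nonempty} := by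
  ext w
  simp only [localTwins, Finset.mem_insert, Finset.mem_filter, Finset.not_nonempty_iff_eq_empty]
  obtain rfl | hwu := eq_or_ne w u
  · simp [hu]
  simp only [hwu, false_or]
  constructor
  · rintro ⟨hxw, heq⟩
    have hw : w ∈ insert u (N x ∩ N u) := heq ▸ Finset.mem_insert_self _ _
    refine ⟨Finset.mem_of_mem_insert_of_ne hw hwu, Finset.eq_empty_of_forall_notMem fun c hc => ?_⟩
    obtain ⟨hc, hcw, hwc⟩ := Finset.mem_filter.1 hc
    have hc' : c ∈ insert w (N x ∩ N w) := heq ▸ Finset.mem_insert_of_mem hc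
    exact hwc (by simpa using (Finset.mem_inter.1 (Finset.mem_of_mem_insert_of_ne hc' hcw)).2)
  · rintro ⟨hw, hco⟩
    have hw' := hw
    simp only [Finset.mem_inter, mem_neighborFinset] at hw'
    refine ⟨(Finset.mem_inter.1 hw).1, (Finset.eq_of_subset_of_card_le (fun c hc => ?_) ?_).symm⟩
    · obtain rfl | hcw := eq_or_ne c w
      · exact Finset.mem_insert_self _ _
      refine Finset.mem_insert_of_mem ?_
      obtain rfl | hc := Finset.mem_insert.1 hc
      · simpa [hu] using hw'.2.symm
      · by_contra hn
        have : c ∈ G.coNeighbors x u w := by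
          refine Finset.mem_filter.2 ⟨hc, hcw, fun h => hn ?_⟩
          exact Finset.mem_inter.2 ⟨(Finset.mem_inter.1 hc).1, by simpa using h⟩
        simp [hco] at this
    · rw [Finset.card_insert_of_notMem (by simp), Finset.card_insert_of_notMem (by simp),
        hl x w hw'.1, hl x u hu]

theorem QuadrangleFree.card_inter_inter (hq : G.QuadrangleFree) {m : ℕ}
    (hm : ∀ a b, a ≠ b → ¬ G.Adj a b → (N a ∩ N b).card = m) {x u v : V} (hu : G.Adj x u)
    (hv : G.Adj x v) (hne : u ≠ v) (huv : ¬ G.Adj u v) :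
    (N x ∩ N u ∩ N v).card = m - 1 := by
  rw [← hm u v hne huv, ← Finset.card_erase_of_mem (a := x) (by simp [hu.symm, hv.symm])]
  congr 1
  ext c
  simp only [Finset.mem_inter, Finset.mem_erase, mem_neighborFinset]
  constructor
  · rintro ⟨⟨hxc, huc⟩, hvc⟩
    exact ⟨hxc.ne', huc, hvc⟩
  · rintro ⟨hcx, huc, hvc⟩
    exact ⟨⟨hq hne hcx.symm hu.symm hv hvc huc.symm huv, huc⟩, hvc⟩

theorem QuadrangleFree.sum_card_coNeighbors (hq : G.QuadrangleFree) {k l m : ℕ}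
    (hk : G.IsRegularOfDegree k) (hl : ∀ a b, G.Adj a b → (N a ∩ N b).card = l)
    (hm : ∀ a b, a ≠ b → ¬ G.Adj a b → (N a ∩ N b).card = m) {x u : V} (hu : G.Adj x u) :
    ∑ w ∈ N x ∩ N u, (G.coNeighbors x u w).card = (k - (l + 1)) * (m - 1) := by
  have hco : ∀ w ∈ N x ∩ N u, (G.coNeighbors x u w).card =
      ((N x \ insert u (N x ∩ N u)).bipartiteAbove G.Adj w).card := by
    intro w hw
    simp only [Finset.mem_inter, mem_neighborFinset] at hw
    have h1 := card_coNeighbors_add hw.1 hw.2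
    have h2 := Finset.card_sdiff_add_card_inter (N x ∩ N w) (insert u (N x ∩ N u))
    have h3 : (N x ∩ N w) ∩ insert u (N x ∩ N u) = insert u (N x ∩ N u ∩ N w) := by
      ext c
      simp only [Finset.mem_inter, Finset.mem_insert, mem_neighborFinset]
      have := hw.2.symm
      grind
    have h4 : (N x ∩ N w) \ insert u (N x ∩ N u) =
        (N x \ insert u (N x ∩ N u)).bipartiteAbove G.Adj w := by
      ext c
      simp only [Finset.mem_inter, Finset.mem_sdiff, Finset.mem_bipartiteAbove,
        mem_neighborFinset]
      tauto
    rw [h3, h4, Finset.card_insert_of_notMem (by simp), hl x w hw.1] at h2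
    rw [hl x u hu] at h1
    omega
  rw [Finset.sum_congr rfl hco, Finset.sum_card_bipartiteAbove_eq_sum_card_bipartiteBelow,
    Finset.sum_const_nat (m := m - 1), Finset.card_sdiff_of_subset,
    Finset.card_insert_of_notMem (by simp), hl x u hu, card_neighborFinset_eq_degree,
    hk.degree_eq]
  · intro c hc
    simp only [Finset.mem_inter, Finset.mem_insert, mem_neighborFinset] at hc ⊢
    rcases hc with rfl | hc
    exacts [hu, hc.1]
  · intro v hv
    simp only [Finset.mem_sdiff, Finset.mem_inter, Finset.mem_insert, mem_neighborFinset] at hv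
    rw [← hq.card_inter_inter hm hu hv.1 (by tauto) (by tauto)]
    congr 1
    ext c
    simp [Finset.mem_bipartiteBelow, G.adj_comm c, and_assoc]

theorem QuadrangleFree.card_localTwins (hq : G.QuadrangleFree) (h : G.IsSRGWith 1911 270 105 27)
    {x u : V} (hu : G.Adj x u) :
    ((G.localTwins x u).card = 2 ∧ ∃ w ∈ N x ∩ N u, (G.coNeighbors x u w).card = 41) ∨
      (G.localTwins x u).card = 24 := by
  have hl : ∀ a b, G.Adj a b → (N a ∩ N b).card = 105 := fun a b => h.card_inter_of_adj
  have hm : ∀ a b, a ≠ b → ¬ G.Adj a b → (N a ∩ N b).card = 27 :=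
    fun a b => h.card_inter_of_not_adj
  have hsum := hq.sum_card_coNeighbors h.regular hl hm hu
  obtain ⟨w, hw, hw0⟩ : ∃ w ∈ N x ∩ N u, (G.coNeighbors x u w).card ≠ 0 := by
    by_contra! hzero
    rw [Finset.sum_eq_zero hzero] at hsum
    norm_num at hsum
  have hwne : (G.coNeighbors x u w).Nonempty := Finset.card_ne_zero.1 hw0
  set M : Finset V := {w ∈ N x ∩ N u | (G.coNeighbors x u w).Nonempty} with hM
  have hprod : M.card * (G.coNeighbors x u w).card = 4264 := by
    rw [← Finset.sum_const_nat (s := M) (f := fun a => (G.coNeighbors x u a).card), hM,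
      Finset.sum_filter_of_ne, hsum]
    · exact fun a _ ha => Finset.card_ne_zero.1 ha
    · intro a ha
      obtain ⟨ha, hane⟩ := Finset.mem_filter.1 ha
      exact hq.card_coNeighbors_eq h.regular hm ha hw hane hwne
  have hlt : (G.coNeighbors x u w).card < M.card := by
    refine Finset.card_lt_card (Finset.ssubset_iff.2 ⟨w, by simp [coNeighbors], ?_⟩)
    refine Finset.insert_subset (Finset.mem_filter.2 ⟨hw, hwne⟩) fun c hc => ?_
    obtain ⟨hc, hcw, hwc⟩ := Finset.mem_filter.1 hc
    exact Finset.mem_filter.2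
      ⟨hc, w, Finset.mem_filter.2 ⟨hw, hcw.symm, fun h => hwc h.symm⟩⟩
  have htwins : (G.localTwins x u).card + M.card = 106 := by
    rw [localTwins_eq hl hu, Finset.card_insert_of_notMem (by simp), add_right_comm,
      add_comm _ M.card, Finset.card_filter_add_card_filter_not, hl x u hu]
  have hle : M.card ≤ 105 := (Finset.card_filter_le _ _).trans (hl x u hu).le
  suffices (M.card = 104 ∧ (G.coNeighbors x u w).card = 41) ∨ M.card = 82 by
    rcases this with ⟨h1, h2⟩ | h1
    · exact Or.inl ⟨by omega, w, hw, h2⟩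
    · exact Or.inr (by omega)
  generalize M.card = p at *
  generalize (G.coNeighbors x u w).card = q at *
  clear_value M
  interval_cases p <;> omega

theorem IsSRGWith.not_quadrangleFree (h : G.IsSRGWith 1911 270 105 27) : ¬ G.QuadrangleFree := by
  intro hq
  obtain ⟨x⟩ : Nonempty V := Fintype.card_pos_iff.1 (by rw [h.card]; norm_num)
  have key : ∀ u ∈ N x, _ := fun u hu =>
    hq.card_localTwins h ((G.mem_neighborFinset x u).1 hu)
  by_cases hex : ∃ u ∈ N x, ∃ w ∈ N x ∩ N u, (G.coNeighbors x u w).card = 41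
  · obtain ⟨u, hu, w, hw, h41⟩ := hex
    simp only [Finset.mem_inter, mem_neighborFinset] at hu hw
    have hsub : G.coNeighbors x u w ⊆ N x :=
      (Finset.filter_subset _ _).trans Finset.inter_subset_left
    have hdvd := dvd_card_of_localTwins (d := 2) hsub
      (fun v hv => localTwins_subset_coNeighbors hv hu hw.1 hw.2)
      (fun v hv => by rcases key v (hsub hv) with ⟨h2, _⟩ | h2 <;> omega)
    omega
  · have hdvd := dvd_card_of_localTwins (d := 24) (Finset.Subset.refl (N x))
      (fun v _ => Finset.filter_subset _ _)
      (fun v hv => by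
        rcases key v hv with ⟨_, h2⟩ | h2
        · exact absurd ⟨v, hv, h2⟩ hex
        · omega)
    rw [card_neighborFinset_eq_degree, h.regular.degree_eq] at hdvd
    omega

end SimpleGraph

/-- If a strongly regular graph `G` with parameters `(1911, 270, 105, 27)` exists, then `G`
contains an induced quadrangle: four distinct vertices `x, u, y, v` with
`x ~ u`, `u ~ y`, `y ~ v`, `v ~ x`, while `x ≁ y` and `u ≁ v`. -/
theorem srg_1911_has_induced_quadrangle {V : Type*} [Fintype V] (G : SimpleGraph V)
    [DecidableRel G.Adj] (h : G.IsSRGWith 1911 270 105 27) :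
    ∃ x u y v : V,
      x ≠ u ∧ x ≠ y ∧ x ≠ v ∧ u ≠ y ∧ u ≠ v ∧ y ≠ v ∧
      G.Adj x u ∧ G.Adj u y ∧ G.Adj y v ∧ G.Adj v x ∧
      ¬ G.Adj x y ∧ ¬ G.Adj u v := by
  classical
  by_contra hno
  refine h.not_quadrangleFree fun x u y v hxy huv hxu huy hyv hvx hnxy => ?_
  by_contra hnuv
  exact hno ⟨x, u, y, v, hxu.ne, hxy, hvx.ne', huy.ne, huv, hyv.ne, hxu, huy, hyv, hvx, hnxy, hnuv⟩
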